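/- Interim equilibrium of information distortion (Corollary 1): let P_n*(·|x,y,a) be stage minimizers of the ex ante backward recursion (which exist under the nonempty-compactness assumption on the interim solution sets). Then each P_n*(·|x,y,a) admits a disintegration P_n*(dx',dy'|x,y,a) = φ_n*(dx'|y'; x,y,a) Q^Y(dy'|x,y,a) by a stochastic kernel φ_n*, and for Q^Y(·|x,y,a)-almost every y' the conditional law φ_n*(·|y'; x,y,a) attains the interim stage value W^Y_{N−n}(y'; x,y,a); the analogous statement holds at stage 0 with Q_0 and Q_0^Y. Consequently the family (φ_0*,…,φ_{N−1}*), together with the decision-maker's rules (ĝ_n), constitutes an interim equilibrium of information distortion, and the interim value coincides with the ex ante value W_N. -/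

import Mathlib

open MeasureTheory
open scoped ENNReal NNReal

noncomputable section

namespace DIMG

/-- `L¹` distance of densities w.r.t. a reference measure `ρ` (twice total variation). -/
noncomputable def tvDist {Z : Type*} [MeasurableSpace Z] (ρ : Measure Z)
    (P P' : Measure Z) : ℝ :=
  ∫ z, |(P.rnDeriv ρ z).toReal - (P'.rnDeriv ρ z).toReal| ∂ρ

/-- Joint measure `P(dx,dy) = φ(dx|y) m(dy)` built from a `Y`-marginal and conditionals. -/
noncomputable def mixJoint {X Y : Type*} [MeasurableSpace X] [MeasurableSpace Y]
    (m : Measure Y) (φ : Y → Measure X) : Measure (X × Y) :=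
  m.bind fun y => (φ y).map fun x => (x, y)

/-- Data of the information manipulation problem: reference measures `lam, ν`; transition
density `q(x',y'|x,y,a)` (argument order `x' y' x y a`); initial density `q0(x,y)`; the
decision-maker's stage decision rules `g n : X → A`; manipulation cost `r`; discount `α`;
horizon `N`. -/
structure ManipSetting (X Y A : Type*) [MeasurableSpace X] [MeasurableSpace Y]
    [MeasurableSpace A] where
  lam : Measure X
  nu : Measure Y
  q : X → Y → X → Y → A → ℝ
  q0 : X → Y → ℝ
  g : ℕ → X → A
  r : X → Y → A → ℝ
  alpha : ℝ
  N : ℕ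

namespace ManipSetting

variable {X Y A : Type*} [MeasurableSpace X] [MeasurableSpace Y] [MeasurableSpace A]

/-- The transition kernel `Q(·,·|x,y,a)` as a measure with density `q` w.r.t. `λ⊗ν`. -/
noncomputable def Qm (M : ManipSetting X Y A) (x : X) (y : Y) (a : A) : Measure (X × Y) :=
  (M.lam.prod M.nu).withDensity fun p => ENNReal.ofReal (M.q p.1 p.2 x y a)

/-- The `Y`-marginal `Q^Y(·|x,y,a)`. -/
noncomputable def QY (M : ManipSetting X Y A) (x : X) (y : Y) (a : A) : Measure Y :=
  (M.Qm x y a).map Prod.snd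

/-- The initial reference measure `Q_0` with density `q0`. -/
noncomputable def Q0m (M : ManipSetting X Y A) : Measure (X × Y) :=
  (M.lam.prod M.nu).withDensity fun p => ENNReal.ofReal (M.q0 p.1 p.2)

/-- The `Y`-marginal `Q_0^Y` of `Q_0`. -/
noncomputable def Q0Y (M : ManipSetting X Y A) : Measure Y := M.Q0m.map Prod.snd

/-- Stagewise consistency at a stage `n ≥ 1` given the previous `(x,y,a)`: `P` is a
probability measure, `P ≪ λ⊗ν`, and the `Y`-marginal of `P` equals `Q^Y(·|x,y,a)`. -/
def Feas (M : ManipSetting X Y A) (x : X) (y : Y) (a : A) (P : Measure (X × Y)) : Prop :=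
  IsProbabilityMeasure P ∧ P ≪ M.lam.prod M.nu ∧ P.map Prod.snd = M.QY x y a

/-- Stagewise consistency at stage `0`. -/
def Feas0 (M : ManipSetting X Y A) (P : Measure (X × Y)) : Prop :=
  IsProbabilityMeasure P ∧ P ≪ M.lam.prod M.nu ∧ P.map Prod.snd = M.Q0Y

/-- The ex ante backward recursion `W`: `W_0 := 0` and, for `j = N−n` (stage `n = N−j`),
`W_j(x,y,a) := inf over stagewise consistent P of
  [α^n (∫ r(x',y',ĝ_n(x')) dP + ∫|dP − dQ(·,·|x,y,a)|) + ∫ W_{j−1}(x',y',ĝ_n(x')) dP]`. -/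
noncomputable def Wrec (M : ManipSetting X Y A) : ℕ → X → Y → A → ℝ
  | 0, _, _, _ => 0
  | j + 1, x, y, a =>
      ⨅ P : {P : Measure (X × Y) // M.Feas x y a P},
        M.alpha ^ (M.N - (j + 1)) *
            ((∫ p, M.r p.1 p.2 (M.g (M.N - (j + 1)) p.1) ∂(P : Measure (X × Y)))
              + tvDist (M.lam.prod M.nu) (P : Measure (X × Y)) (M.Qm x y a))
          + ∫ p, Wrec M j p.1 p.2 (M.g (M.N - (j + 1)) p.1) ∂(P : Measure (X × Y))

/-- Objective of the stage problem defining `W_j(x,y,a)` (for `j ≥ 1`). -/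
noncomputable def stageObj (M : ManipSetting X Y A) (j : ℕ) (x : X) (y : Y) (a : A)
    (P : Measure (X × Y)) : ℝ :=
  M.alpha ^ (M.N - j) *
      ((∫ p, M.r p.1 p.2 (M.g (M.N - j) p.1) ∂P)
        + tvDist (M.lam.prod M.nu) P (M.Qm x y a))
    + ∫ p, M.Wrec (j - 1) p.1 p.2 (M.g (M.N - j) p.1) ∂P

/-- Objective of the stage-`0` problem defining `W_N`. -/
noncomputable def stage0Obj (M : ManipSetting X Y A) (P : Measure (X × Y)) : ℝ :=
  (∫ p, M.r p.1 p.2 (M.g 0 p.1) ∂P) + tvDist (M.lam.prod M.nu) P M.Q0m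
    + ∫ p, M.Wrec (M.N - 1) p.1 p.2 (M.g 0 p.1) ∂P

/-- The top value `W_N` of the backward recursion. -/
noncomputable def WNval (M : ManipSetting X Y A) : ℝ :=
  ⨅ P : {P : Measure (X × Y) // M.Feas0 P}, M.stage0Obj (P : Measure (X × Y))

/-- Objective of the interim stage problem defining `W^Y_j(y'; x,y,a)` (for `j ≥ 1`), where
`ψ` is the disintegration kernel of `Q(·,·|x,y,a)` over `Q^Y(·|x,y,a)`. -/
noncomputable def interimObj (M : ManipSetting X Y A) (ψ : X → Y → A → Y → Measure X)
    (j : ℕ) (y' : Y) (x : X) (y : Y) (a : A) (η : Measure X) : ℝ :=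
  M.alpha ^ (M.N - j) *
      ((∫ x', M.r x' y' (M.g (M.N - j) x') ∂η) + tvDist M.lam η (ψ x y a y'))
    + ∫ x', M.Wrec (j - 1) x' y' (M.g (M.N - j) x') ∂η

/-- The interim stage value `W^Y_j(y'; x,y,a)`,
`inf over η ∈ P(X), η ≪ λ of interimObj`. -/
noncomputable def WYval (M : ManipSetting X Y A) (ψ : X → Y → A → Y → Measure X)
    (j : ℕ) (y' : Y) (x : X) (y : Y) (a : A) : ℝ :=
  ⨅ η : {η : Measure X // IsProbabilityMeasure η ∧ η ≪ M.lam},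
    M.interimObj ψ j y' x y a (η : Measure X)

/-- Objective of the interim problem at stage `0` with reference disintegration `ψ0` of
`Q_0` over `Q_0^Y`. -/
noncomputable def interim0Obj (M : ManipSetting X Y A) (ψ0 : Y → Measure X) (y : Y)
    (η : Measure X) : ℝ :=
  (∫ x', M.r x' y (M.g 0 x') ∂η) + tvDist M.lam η (ψ0 y)
    + ∫ x', M.Wrec (M.N - 1) x' y (M.g 0 x') ∂η

/-- The interim value `W^Y_N(y; Q_0)` at stage `0`. -/
noncomputable def WY0val (M : ManipSetting X Y A) (ψ0 : Y → Measure X) (y : Y) : ℝ :=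
  ⨅ η : {η : Measure X // IsProbabilityMeasure η ∧ η ≪ M.lam},
    M.interim0Obj ψ0 y (η : Measure X)

end ManipSetting

/-- Standing hypotheses on a manipulation setting. -/
structure ManipHyps {X Y A : Type*} [MeasurableSpace X] [MeasurableSpace Y]
    [MeasurableSpace A] (M : ManipSetting X Y A) : Prop where
  lam_prob : IsProbabilityMeasure M.lam
  nu_prob : IsProbabilityMeasure M.nu
  q_meas : Measurable fun p : X × Y × X × Y × A => M.q p.1 p.2.1 p.2.2.1 p.2.2.2.1 p.2.2.2.2
  q_nonneg : ∀ x' y' x y a, 0 ≤ M.q x' y' x y a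
  q_bdd : ∃ C : ℝ, ∀ x' y' x y a, M.q x' y' x y a ≤ C
  q_dens : ∀ x y a, ∫⁻ p : X × Y, ENNReal.ofReal (M.q p.1 p.2 x y a) ∂(M.lam.prod M.nu) = 1
  q0_meas : Measurable fun p : X × Y => M.q0 p.1 p.2
  q0_nonneg : ∀ x y, 0 ≤ M.q0 x y
  q0_dens : ∫⁻ p : X × Y, ENNReal.ofReal (M.q0 p.1 p.2) ∂(M.lam.prod M.nu) = 1
  g_meas : ∀ n, Measurable (M.g n)
  r_meas : Measurable fun p : X × Y × A => M.r p.1 p.2.1 p.2.2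
  r_nonneg : ∀ x y a, 0 ≤ M.r x y a
  r_bdd : ∃ C : ℝ, ∀ x y a, M.r x y a ≤ C
  alpha_pos : 0 < M.alpha
  alpha_lt_one : M.alpha < 1
  N_pos : 1 ≤ M.N

/-- `ψ` is a family of disintegration kernels of `Q(·,·|x,y,a)` over `Q^Y(·|x,y,a)` and
`ψ0` one of `Q_0` over `Q_0^Y`. -/
structure DisintHyps {X Y A : Type*} [MeasurableSpace X] [MeasurableSpace Y]
    [MeasurableSpace A] (M : ManipSetting X Y A) (ψ : X → Y → A → Y → Measure X)
    (ψ0 : Y → Measure X) : Prop where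
  ψ_meas : ∀ x y a, Measurable (ψ x y a)
  ψ_prob : ∀ x y a y', IsProbabilityMeasure (ψ x y a y')
  ψ_ac : ∀ x y a y', ψ x y a y' ≪ M.lam
  ψ_dis : ∀ x y a, M.Qm x y a = mixJoint (M.QY x y a) (ψ x y a)
  ψ0_meas : Measurable ψ0
  ψ0_prob : ∀ y, IsProbabilityMeasure (ψ0 y)
  ψ0_ac : ∀ y, ψ0 y ≪ M.lam
  ψ0_dis : M.Q0m = mixJoint M.Q0Y ψ0

/-- The interim solution sets, as subsets of `P(X)` (with the weak topology). -/
def interimSolSet {X Y A : Type*} [MeasurableSpace X] [MeasurableSpace Y] [MeasurableSpace A]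
    (M : ManipSetting X Y A) (ψ : X → Y → A → Y → Measure X)
    (j : ℕ) (y' : Y) (x : X) (y : Y) (a : A) : Set (ProbabilityMeasure X) :=
  {η : ProbabilityMeasure X | (η : Measure X) ≪ M.lam ∧
    M.interimObj ψ j y' x y a (η : Measure X) = M.WYval ψ j y' x y a}

/-- The interim solution set of the stage-`0` problem. -/
def interim0SolSet {X Y A : Type*} [MeasurableSpace X] [MeasurableSpace Y] [MeasurableSpace A]
    (M : ManipSetting X Y A) (ψ0 : Y → Measure X) (y : Y) : Set (ProbabilityMeasure X) :=
  {η : ProbabilityMeasure X | (η : Measure X) ≪ M.lam ∧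
    M.interim0Obj ψ0 y (η : Measure X) = M.WY0val ψ0 y}

section FiniteMeasures

variable {Z : Type*} [MeasurableSpace Z] {ρ η ψ μ : Measure Z}

theorem integrable_of_bounded [IsFiniteMeasure μ] {f : Z → ℝ} {C : ℝ} (hf : Measurable f)
    (hC : ∀ z, |f z| ≤ C) : Integrable f μ :=
  Integrable.of_bound hf.aestronglyMeasurable C (ae_of_all _ hC)

theorem abs_truncation_le {s t C β : ℝ} (hs : |s| ≤ C) (ht : |t| ≤ C) (hβ : 0 ≤ β) :
    |min s (t + 2 * β)| ≤ C + 2 * β := by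
  rw [abs_le] at *
  constructor
  · rw [le_min_iff]; constructor <;> linarith
  · exact (min_le_left _ _).trans (by linarith)

theorem truncated_integral_le [SigmaFinite ρ] [IsFiniteMeasure η] [IsFiniteMeasure ψ]
    (hη : η ≪ ρ) (hψ : ψ ≪ ρ) {c w : Z → ℝ} {C β : ℝ} (hc : Measurable c) (hw : Measurable w)
    (hcC : ∀ z, |c z| ≤ C) (hwC : ∀ z, |w z| ≤ C) (hwc : w ≤ᵐ[ρ] c) (hβ : 0 ≤ β)
    (hmass : η.real Set.univ = ψ.real Set.univ) (hint : ∫ z, w z ∂η = ∫ z, w z ∂ψ) :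
    ∫ z, min (c z) (w z + 2 * β) ∂ψ ≤ ∫ z, c z ∂η + β * tvDist ρ η ψ := by
  have i1 : Integrable (fun z => (ψ.rnDeriv ρ z).toReal • min (c z) (w z + 2 * β)) ρ :=
    (integrable_rnDeriv_smul_iff hψ).2 (integrable_of_bounded (hc.min (hw.add_const _))
      fun z => abs_truncation_le (hcC z) (hwC z) hβ)
  have i2 : Integrable (fun z => (η.rnDeriv ρ z).toReal • c z) ρ :=
    (integrable_rnDeriv_smul_iff hη).2 (integrable_of_bounded hc hcC)
  have iw : ∀ μ : Measure Z, IsFiniteMeasure μ → Integrable w μ :=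
    fun μ _ => integrable_of_bounded hw hwC
  have i3 : Integrable (fun z => (ψ.rnDeriv ρ z).toReal • (w z + β)) ρ :=
    (integrable_rnDeriv_smul_iff hψ).2 ((iw ψ inferInstance).add (integrable_const β))
  have i4 : Integrable (fun z => (η.rnDeriv ρ z).toReal • (w z + β)) ρ :=
    (integrable_rnDeriv_smul_iff hη).2 ((iw η inferInstance).add (integrable_const β))
  have i5 : Integrable (fun z => |(η.rnDeriv ρ z).toReal - (ψ.rnDeriv ρ z).toReal|) ρ :=
    (Measure.integrable_toReal_rnDeriv.sub Measure.integrable_toReal_rnDeriv).abs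
  have i6 : Integrable (fun z => (η.rnDeriv ρ z).toReal • c z
      + β * |(η.rnDeriv ρ z).toReal - (ψ.rnDeriv ρ z).toReal|) ρ := i2.add (i5.const_mul β)
  have i7 : Integrable (fun z => (ψ.rnDeriv ρ z).toReal • (w z + β)
      - (η.rnDeriv ρ z).toReal • (w z + β)) ρ := i3.sub i4
  have key : ∫ z, (ψ.rnDeriv ρ z).toReal • min (c z) (w z + 2 * β) ∂ρ ≤
      ∫ z, ((η.rnDeriv ρ z).toReal • c z
        + β * |(η.rnDeriv ρ z).toReal - (ψ.rnDeriv ρ z).toReal|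
        + ((ψ.rnDeriv ρ z).toReal • (w z + β) - (η.rnDeriv ρ z).toReal • (w z + β))) ∂ρ := by
    refine integral_mono_ae i1 (i6.add i7) ?_
    filter_upwards [hwc] with z hz
    have hp : 0 ≤ (ψ.rnDeriv ρ z).toReal := ENNReal.toReal_nonneg
    have hf : 0 ≤ (η.rnDeriv ρ z).toReal := ENNReal.toReal_nonneg
    generalize (ψ.rnDeriv ρ z).toReal = p at *
    generalize (η.rnDeriv ρ z).toReal = f at *
    simp only [smul_eq_mul]
    rcases le_total p f with h | h
    · rw [abs_of_nonneg (by linarith)]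
      have h1 := mul_le_mul_of_nonneg_left (min_le_left (c z) (w z + 2 * β)) hp
      nlinarith [mul_nonneg (sub_nonneg.2 h) (sub_nonneg.2 hz)]
    · rw [abs_of_nonpos (by linarith)]
      have h1 := mul_le_mul_of_nonneg_left (min_le_left (c z) (w z + 2 * β)) hf
      have h2 := mul_le_mul_of_nonneg_left (min_le_right (c z) (w z + 2 * β)) (sub_nonneg.2 h)
      nlinarith
  rw [integral_add i6 i7, integral_add i2 (i5.const_mul β),
    integral_sub i3 i4, integral_rnDeriv_smul hψ, integral_rnDeriv_smul hψ,
    integral_rnDeriv_smul hη, integral_rnDeriv_smul hη, integral_const_mul,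
    integral_add (iw ψ inferInstance) (integrable_const β),
    integral_add (iw η inferInstance) (integrable_const β), integral_const, integral_const,
    hmass, hint] at key
  unfold tvDist
  linarith

theorem tvDist_le_of_common_part [SigmaFinite ρ] [IsFiniteMeasure η] [IsFiniteMeasure ψ]
    (hη : η ≪ ρ) (hψ : ψ ≪ ρ) (h1 : μ ≤ η) (h2 : μ ≤ ψ)
    (hmass : η.real Set.univ = ψ.real Set.univ) :
    tvDist ρ η ψ ≤ 2 * (ψ.real Set.univ - μ.real Set.univ) := by
  have : IsFiniteMeasure μ := isFiniteMeasure_of_le η h1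
  have hμ : μ ≪ ρ := h1.absolutelyContinuous.trans hη
  have key : ∀ κ : Measure Z, IsFiniteMeasure κ → μ ≤ κ →
      ∀ᵐ z ∂ρ, (μ.rnDeriv ρ z).toReal ≤ (κ.rnDeriv ρ z).toReal := by
    intro κ _ hk
    have e : κ = (κ - μ) + μ := (Measure.sub_add_cancel_of_le hk).symm
    have := Measure.rnDeriv_add' (κ - μ) μ ρ
    rw [← e] at this
    filter_upwards [this, κ.rnDeriv_lt_top ρ] with z hz hlt
    exact ENNReal.toReal_mono hlt.ne (by rw [hz]; exact le_add_self)
  have i (κ : Measure Z) [IsFiniteMeasure κ] : Integrable (fun z => (κ.rnDeriv ρ z).toReal) ρ :=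
    Measure.integrable_toReal_rnDeriv
  have hημ : Integrable (fun z => (η.rnDeriv ρ z).toReal - (μ.rnDeriv ρ z).toReal) ρ :=
    (i η).sub (i μ)
  have hψμ : Integrable (fun z => (ψ.rnDeriv ρ z).toReal - (μ.rnDeriv ρ z).toReal) ρ :=
    (i ψ).sub (i μ)
  have : tvDist ρ η ψ ≤ ∫ z, (((η.rnDeriv ρ z).toReal - (μ.rnDeriv ρ z).toReal)
      + ((ψ.rnDeriv ρ z).toReal - (μ.rnDeriv ρ z).toReal)) ∂ρ := by
    refine integral_mono_ae ((i η).sub (i ψ)).abs (hημ.add hψμ) ?_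
    filter_upwards [key η inferInstance h1, key ψ inferInstance h2] with z hz1 hz2
    simp only [abs_le]
    constructor <;> linarith
  rw [integral_add hημ hψμ, integral_sub (i η) (i μ),
    integral_sub (i ψ) (i μ), Measure.integral_toReal_rnDeriv hη,
    Measure.integral_toReal_rnDeriv hψ, Measure.integral_toReal_rnDeriv hμ, hmass] at this
  linarith

theorem exists_density_common_part [SigmaFinite ρ] [IsFiniteMeasure η] [IsFiniteMeasure ψ]
    (hη : η ≪ ρ) (hψ : ψ ≪ ρ) (hmass : η.real Set.univ = ψ.real Set.univ) :
    ∃ k : Z → ℝ≥0, Measurable k ∧ (∀ z, k z ≤ 1) ∧ ψ.withDensity (fun z => k z) ≤ η ∧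
      2 * ∫ z, (1 - (k z : ℝ)) ∂ψ = tvDist ρ η ψ := by
  set f : Z → ℝ≥0 := fun z => (η.rnDeriv ρ z).toNNReal with hf
  set p : Z → ℝ≥0 := fun z => (ψ.rnDeriv ρ z).toNNReal with hp
  have hfm : Measurable f := (Measure.measurable_rnDeriv η ρ).ennreal_toNNReal
  have hpm : Measurable p := (Measure.measurable_rnDeriv ψ ρ).ennreal_toNNReal
  set k : Z → ℝ≥0 := fun z => min 1 (f z / p z) with hk
  have hkm : Measurable k := measurable_const.min (hfm.div hpm)
  have hkp : ∀ z, p z * k z = min (f z) (p z) := by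
    intro z
    rcases eq_or_ne (p z) 0 with h | h
    · simp [h]
    · rw [hk]
      simp only
      rw [mul_min, mul_one, mul_div_cancel₀ _ h, min_comm]
  have dens : ∀ κ : Measure Z, IsFiniteMeasure κ → κ ≪ ρ →
      ρ.withDensity (fun z => ((κ.rnDeriv ρ z).toNNReal : ℝ≥0∞)) = κ := by
    intro κ _ hκ
    conv_rhs => rw [← Measure.withDensity_rnDeriv_eq κ ρ hκ]
    refine withDensity_congr_ae ?_
    filter_upwards [κ.rnDeriv_lt_top ρ] with z hz
    exact ENNReal.coe_toNNReal hz.ne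
  refine ⟨k, hkm, fun z => min_le_left _ _, ?_, ?_⟩
  · conv_lhs => rw [← dens ψ inferInstance hψ]
    conv_rhs => rw [← dens η inferInstance hη]
    rw [← withDensity_mul _ hpm.coe_nnreal_ennreal hkm.coe_nnreal_ennreal]
    refine withDensity_mono (ae_of_all _ fun z => ?_)
    simp only [Pi.mul_apply]
    rw [← ENNReal.coe_mul, hkp z]
    exact_mod_cast min_le_left _ _
  · have i (κ : Measure Z) [IsFiniteMeasure κ] :
        Integrable (fun z => (κ.rnDeriv ρ z).toReal) ρ := Measure.integrable_toReal_rnDeriv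
    rw [← integral_rnDeriv_smul hψ, ← integral_const_mul]
    have : ∀ z, 2 * ((ψ.rnDeriv ρ z).toReal • (1 - (k z : ℝ)))
        = |(η.rnDeriv ρ z).toReal - (ψ.rnDeriv ρ z).toReal|
          + ((ψ.rnDeriv ρ z).toReal - (η.rnDeriv ρ z).toReal) := by
      intro z
      have h := congrArg (fun t : ℝ≥0 => (t : ℝ)) (hkp z)
      simp only [NNReal.coe_mul, NNReal.coe_min] at h
      change 2 * ((p z : ℝ) • (1 - (k z : ℝ))) = |(f z : ℝ) - p z| + (p z - f z)
      rw [smul_eq_mul, mul_sub, h, mul_one]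
      rcases le_total (f z : ℝ) (p z) with h | h
      · rw [min_eq_left h, abs_of_nonpos (by linarith)]; ring
      · rw [min_eq_right h, abs_of_nonneg (by linarith)]; ring
    have habs : Integrable (fun z => |(η.rnDeriv ρ z).toReal - (ψ.rnDeriv ρ z).toReal|) ρ :=
      ((i η).sub (i ψ)).abs
    have hsub : Integrable (fun z => (ψ.rnDeriv ρ z).toReal - (η.rnDeriv ρ z).toReal) ρ :=
      (i ψ).sub (i η)
    simp_rw [this]
    rw [integral_add habs hsub, integral_sub (i ψ) (i η),
      Measure.integral_toReal_rnDeriv hη, Measure.integral_toReal_rnDeriv hψ, hmass, sub_self,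
      add_zero, tvDist]

/-- Moving the mass of `ψ` on `{w + 2 β < c}` to a measure `κ` concentrated where `c ≤ w + ε`
is `ε`-optimal. -/
theorem cost_transfer_le [SigmaFinite ρ] [IsProbabilityMeasure ψ] (hψ : ψ ≪ ρ) {κ : Measure Z}
    [IsFiniteMeasure κ] (hκ : κ ≪ ρ) {c w : Z → ℝ} {C β ε : ℝ} (hc : Measurable c)
    (hw : Measurable w) (hcC : ∀ z, |c z| ≤ C) (hwC : ∀ z, |w z| ≤ C) (hβ : 0 ≤ β) (hε : 0 ≤ ε)
    (hmass : κ Set.univ = ψ {z | w z + 2 * β < c z})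
    (hint : ∫ z, w z ∂κ = ∫ z in {z | w z + 2 * β < c z}, w z ∂ψ)
    (hle : ∀ᵐ z ∂κ, c z ≤ w z + ε) :
    IsProbabilityMeasure (ψ.restrict {z | w z + 2 * β < c z}ᶜ + κ) ∧
      (ψ.restrict {z | w z + 2 * β < c z}ᶜ + κ) ≪ ρ ∧
      ∫ z, c z ∂(ψ.restrict {z | w z + 2 * β < c z}ᶜ + κ)
          + β * tvDist ρ (ψ.restrict {z | w z + 2 * β < c z}ᶜ + κ) ψ
        ≤ ∫ z, min (c z) (w z + 2 * β) ∂ψ + ε := by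
  set B : Set Z := {z | w z + 2 * β < c z} with hB
  have hBm : MeasurableSet B := measurableSet_lt (hw.add_const _) hc
  have hac : (ψ.restrict Bᶜ + κ) ≪ ρ := by
    refine Measure.AbsolutelyContinuous.add_left_iff.2 ⟨?_, hκ⟩
    exact Measure.absolutelyContinuous_of_le Measure.restrict_le_self |>.trans hψ
  have hprob : IsProbabilityMeasure (ψ.restrict Bᶜ + κ) := by
    constructor
    rw [Measure.add_apply, hmass, Measure.restrict_apply_univ, add_comm,
      measure_add_measure_compl hBm, measure_univ]
  refine ⟨hprob, hac, ?_⟩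
  have htv := tvDist_le_of_common_part (ρ := ρ) (η := ψ.restrict Bᶜ + κ) (ψ := ψ)
    (μ := ψ.restrict Bᶜ) hac hψ (Measure.le_add_right le_rfl) Measure.restrict_le_self (by simp)
  have hBr : ψ.real Set.univ - (ψ.restrict Bᶜ).real Set.univ = ψ.real B := by
    rw [measureReal_restrict_apply_univ, ← measureReal_add_measureReal_compl hBm]; ring
  rw [hBr] at htv
  have ic (μ : Measure Z) [IsFiniteMeasure μ] : Integrable c μ := integrable_of_bounded hc hcC
  have iw (μ : Measure Z) [IsFiniteMeasure μ] : Integrable w μ := integrable_of_bounded hw hwC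
  have hsplit : ∫ z, min (c z) (w z + 2 * β) ∂ψ
      = ∫ z in B, (w z + 2 * β) ∂ψ + ∫ z in Bᶜ, c z ∂ψ := by
    have hmin : Integrable (fun z => min (c z) (w z + 2 * β)) ψ :=
      (ic ψ).inf ((iw ψ).add (integrable_const (2 * β)))
    rw [← integral_add_compl hBm hmin]
    congr 1
    · exact setIntegral_congr_fun hBm fun z hz => min_eq_right (le_of_lt hz)
    · exact setIntegral_congr_fun hBm.compl fun z hz => min_eq_left (not_lt.1 hz)
  have hk : ∫ z, c z ∂κ ≤ ∫ z, w z ∂κ + ε * κ.real Set.univ := by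
    have := integral_mono_ae (ic κ) ((iw κ).add (integrable_const ε)) hle
    simp only [Pi.add_apply] at this
    rw [integral_add (iw κ) (integrable_const ε), integral_const, smul_eq_mul] at this
    linarith
  have hκB : κ.real Set.univ = ψ.real B := by simp [measureReal_def, hmass]
  rw [integral_add_measure (ic _) (ic _), hsplit, integral_add (iw _) (integrable_const _),
    setIntegral_const, smul_eq_mul]
  rw [hint, hκB] at hk
  have hB1 : ψ.real B ≤ 1 := measureReal_le_one
  nlinarith [mul_le_mul_of_nonneg_left htv hβ, mul_le_mul_of_nonneg_left hB1 hε]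

end FiniteMeasures

section Disintegration

open ProbabilityTheory

variable {X Y : Type*} [MeasurableSpace X] [MeasurableSpace Y]
  {lam : Measure X} {nu m : Measure Y}

theorem measurable_map_prodMk (κ : Kernel Y X) [IsSFiniteKernel κ] :
    Measurable fun y => (κ y).map fun x => (x, y) := by
  refine Measure.measurable_of_measurable_coe _ fun S hS => ?_
  simp_rw [Measure.map_apply measurable_prodMk_right hS]
  exact Kernel.measurable_kernel_prodMk_left (κ := κ) (measurable_swap hS)

theorem mixJoint_apply (κ : Kernel Y X) [IsSFiniteKernel κ] {S : Set (X × Y)}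
    (hS : MeasurableSet S) :
    mixJoint m κ S = ∫⁻ y, κ y ((fun x => (x, y)) ⁻¹' S) ∂m := by
  rw [mixJoint, Measure.bind_apply hS (measurable_map_prodMk κ).aemeasurable]
  simp_rw [Measure.map_apply measurable_prodMk_right hS]

theorem mixJoint_eq_map_swap [SFinite m] (κ : Kernel Y X) [IsSFiniteKernel κ] :
    mixJoint m κ = (m ⊗ₘ κ).map Prod.swap := by
  ext S hS
  rw [mixJoint_apply κ hS, Measure.map_apply measurable_swap hS,
    Measure.compProd_apply (measurable_swap hS)]
  rfl

theorem mixJoint_snd_apply (κ : Kernel Y X) [IsSFiniteKernel κ] {T : Set Y}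
    (hT : MeasurableSet T) :
    (mixJoint m κ).map Prod.snd T = ∫⁻ y in T, κ y Set.univ ∂m := by
  rw [Measure.map_apply measurable_snd hT, mixJoint_apply κ (measurable_snd hT),
    ← lintegral_indicator hT]
  refine lintegral_congr fun y => ?_
  by_cases hy : y ∈ T
  · rw [Set.indicator_of_mem hy]
    congr 1
    ext x
    simpa using hy
  · rw [Set.indicator_of_notMem hy]
    have : (fun x : X => (x, y)) ⁻¹' (Prod.snd ⁻¹' T) = ∅ := by
      ext x
      simpa using hy
    rw [this, measure_empty]

theorem mixJoint_map_snd (κ : Kernel Y X) [IsMarkovKernel κ] :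
    (mixJoint m κ).map Prod.snd = m := by
  ext T hT
  rw [mixJoint_snd_apply κ hT]
  simp

theorem isFiniteMeasure_mixJoint [IsFiniteMeasure m] (κ : Kernel Y X) [IsMarkovKernel κ] :
    IsFiniteMeasure (mixJoint m κ) := by
  rw [mixJoint_eq_map_swap]
  infer_instance

theorem integral_mixJoint [IsFiniteMeasure m] (κ : Kernel Y X) [IsMarkovKernel κ]
    {f : X × Y → ℝ} {C : ℝ} (hf : Measurable f) (hC : ∀ p, |f p| ≤ C) :
    ∫ p, f p ∂(mixJoint m κ) = ∫ y, ∫ x, f (x, y) ∂(κ y) ∂m := by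
  rw [mixJoint_eq_map_swap, integral_map measurable_swap.aemeasurable hf.aestronglyMeasurable,
    Measure.integral_compProd (f := fun p : Y × X => f p.swap)
      (integrable_of_bounded (hf.comp measurable_swap) fun _ => hC _)]
  rfl

theorem integrable_integral_kernel [IsFiniteMeasure m] (κ : Kernel Y X) [IsMarkovKernel κ]
    {f : X × Y → ℝ} {C : ℝ} (hf : Measurable f) (hC : ∀ p, |f p| ≤ C) :
    Integrable (fun y => ∫ x, f (x, y) ∂(κ y)) m :=
  (integrable_of_bounded (μ := m ⊗ₘ κ) (f := fun p => f p.swap) (hf.comp measurable_swap)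
    fun _ => hC _).integral_compProd

theorem lintegral_mixJoint [SFinite m] (κ : Kernel Y X) [IsSFiniteKernel κ]
    {f : X × Y → ℝ≥0∞} (hf : Measurable f) :
    ∫⁻ p, f p ∂(mixJoint m κ) = ∫⁻ y, ∫⁻ x, f (x, y) ∂(κ y) ∂m := by
  rw [mixJoint_eq_map_swap, lintegral_map hf measurable_swap,
    Measure.lintegral_compProd (f := fun p : Y × X => f p.swap) (hf.comp measurable_swap)]
  rfl

theorem mixJoint_withDensity [SFinite m] (κ : Kernel Y X) [IsSFiniteKernel κ]
    {k : X × Y → ℝ≥0} (hk : Measurable k) :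
    mixJoint m (Kernel.withDensity κ fun y x => (k (x, y) : ℝ≥0∞))
      = (mixJoint m κ).withDensity fun p => (k p : ℝ≥0∞) := by
  have hk' : Measurable (Function.uncurry fun y x => (k (x, y) : ℝ≥0∞)) :=
    (hk.comp measurable_swap).coe_nnreal_ennreal
  ext S hS
  rw [mixJoint_apply _ hS, withDensity_apply _ hS, ← lintegral_indicator hS,
    lintegral_mixJoint κ (hk.coe_nnreal_ennreal.indicator hS)]
  refine lintegral_congr fun y => ?_
  rw [Kernel.withDensity_apply' _ hk', ← lintegral_indicator (measurable_prodMk_right hS)]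
  rfl

theorem mixJoint_add (κ κ' : Kernel Y X) [IsSFiniteKernel κ] [IsSFiniteKernel κ'] :
    mixJoint m (κ + κ' : Kernel Y X) = mixJoint m κ + mixJoint m κ' := by
  ext S hS
  rw [Measure.add_apply, mixJoint_apply _ hS, mixJoint_apply _ hS, mixJoint_apply _ hS,
    ← lintegral_add_left (f := fun y => κ y ((fun x => (x, y)) ⁻¹' S))
      (Kernel.measurable_kernel_prodMk_left (κ := κ) (measurable_swap hS))]
  rfl

theorem mixJoint_congr_ae {κ κ' : Kernel Y X} [IsSFiniteKernel κ] [IsSFiniteKernel κ']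
    (h : ∀ᵐ y ∂m, κ y = κ' y) : mixJoint m κ = mixJoint m κ' := by
  ext S hS
  rw [mixJoint_apply _ hS, mixJoint_apply _ hS]
  exact lintegral_congr_ae (h.mono fun y hy => by simp only [hy])

theorem ae_isProbabilityMeasure_of_mixJoint_map_snd [IsFiniteMeasure m] (κ : Kernel Y X)
    [IsSFiniteKernel κ] (h : (mixJoint m κ).map Prod.snd = m) :
    ∀ᵐ y ∂m, κ y Set.univ = 1 := by
  refine ae_eq_of_forall_setLIntegral_eq_of_sigmaFinite (Kernel.measurable_coe κ .univ)
    measurable_const fun T hT _ => ?_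
  rw [← mixJoint_snd_apply κ hT, h]
  simp

theorem mixJoint_absolutelyContinuous [SFinite lam] [SFinite nu] (κ : Kernel Y X)
    [IsSFiniteKernel κ] (hm : m ≪ nu) (hκ : ∀ y, κ y ≪ lam) :
    mixJoint m κ ≪ lam.prod nu := by
  refine Measure.AbsolutelyContinuous.mk fun S hS h0 => ?_
  rw [mixJoint_apply κ hS]
  rw [Measure.prod_apply_symm hS, lintegral_eq_zero_iff (measurable_measure_prodMk_right hS)] at h0
  have : (fun y => κ y ((fun x => (x, y)) ⁻¹' S)) =ᵐ[m] 0 := by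
    filter_upwards [hm.ae_le h0] with y hy
    exact hκ y hy
  rw [lintegral_congr_ae this]
  simp

theorem map_snd_absolutelyContinuous [SFinite nu] {Q : Measure (X × Y)}
    (hQ : Q ≪ lam.prod nu) : Q.map Prod.snd ≪ nu := by
  refine Measure.AbsolutelyContinuous.mk fun T hT h0 => ?_
  rw [Measure.map_apply measurable_snd hT]
  refine hQ ?_
  rw [← Set.univ_prod, Measure.prod_prod, h0, mul_zero]

theorem exists_kernel_mixJoint_eq [SFinite lam] [SigmaFinite nu] [IsFiniteMeasure m]
    {κ : Measure (X × Y)} [IsFiniteMeasure κ] (hκ : κ ≪ lam.prod nu) [SigmaFinite (lam.prod nu)]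
    (hm : m ≪ nu) (hκm : κ.map Prod.snd ≪ m) :
    ∃ E : Kernel Y X, IsSFiniteKernel E ∧ (∀ y, E y ≪ lam) ∧ κ = mixJoint m E := by
  set e : X × Y → ℝ≥0 := fun p => (κ.rnDeriv (lam.prod nu) p).toNNReal with he
  set s : Y → ℝ≥0 := fun y => (m.rnDeriv nu y).toNNReal with hs
  have hem : Measurable e := (Measure.measurable_rnDeriv _ _).ennreal_toNNReal
  have hsm : Measurable s := (Measure.measurable_rnDeriv _ _).ennreal_toNNReal
  have hκe : (lam.prod nu).withDensity (fun p => (e p : ℝ≥0∞)) = κ := by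
    conv_rhs => rw [← Measure.withDensity_rnDeriv_eq κ _ hκ]
    refine withDensity_congr_ae ?_
    filter_upwards [κ.rnDeriv_lt_top (lam.prod nu)] with z hz
    exact ENNReal.coe_toNNReal hz.ne
  have hms : nu.withDensity (fun y => (s y : ℝ≥0∞)) = m := by
    conv_rhs => rw [← Measure.withDensity_rnDeriv_eq m _ hm]
    refine withDensity_congr_ae ?_
    filter_upwards [m.rnDeriv_lt_top nu] with z hz
    exact ENNReal.coe_toNNReal hz.ne
  set d : Y → X → ℝ≥0 := fun y x => e (x, y) * (s y)⁻¹ with hd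
  have hdm : Measurable (Function.uncurry fun y x => ((d y x : ℝ≥0) : ℝ≥0∞)) :=
    ((hem.comp measurable_swap).mul (hsm.comp measurable_fst).inv).coe_nnreal_ennreal
  set E : Kernel Y X := Kernel.withDensity (Kernel.const Y lam) fun y x => (d y x : ℝ≥0∞) with hE
  have hEy : ∀ y, E y = lam.withDensity fun x => (d y x : ℝ≥0∞) := fun y => by
    rw [hE, Kernel.withDensity_apply _ hdm, Kernel.const_apply]
  have hEs : IsSFiniteKernel E := by
    rw [hE]; infer_instance
  refine ⟨E, hEs, fun y => ?_, ?_⟩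
  · rw [hEy]
    exact withDensity_absolutelyContinuous _ _
  have hzero : ∀ᵐ y ∂nu, s y = 0 → ∫⁻ x, (e (x, y) : ℝ≥0∞) ∂lam = 0 := by
    set T : Set Y := {y | s y = 0} with hT
    have hTm : MeasurableSet T := hsm (measurableSet_singleton 0)
    have hmT : m T = 0 := by
      rw [← hms, withDensity_apply _ hTm]
      exact setLIntegral_eq_zero hTm fun y (hy : s y = 0) => by simp [hy]
    have h := hκm hmT
    rw [Measure.map_apply measurable_snd hTm, ← hκe,
      withDensity_apply _ (measurable_snd hTm), ← Set.univ_prod, ← Measure.prod_restrict,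
      Measure.restrict_univ, lintegral_prod_symm' _ hem.coe_nnreal_ennreal,
      lintegral_eq_zero_iff (hem.coe_nnreal_ennreal.lintegral_prod_left'),
      Filter.EventuallyEq, ae_restrict_iff' hTm] at h
    exact h
  ext S hS
  rw [mixJoint_apply E hS]
  conv_lhs => rw [← hκe]
  conv_rhs => rw [← hms]
  rw [withDensity_apply _ hS, ← lintegral_indicator hS,
    lintegral_prod_symm' _ (hem.coe_nnreal_ennreal.indicator hS),
    lintegral_withDensity_eq_lintegral_mul _ hsm.coe_nnreal_ennreal
      (g := fun y => E y ((fun x => (x, y)) ⁻¹' S)) (Kernel.measurable_kernel_prodMk_left (κ := E) (measurable_swap hS))]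
  refine lintegral_congr_ae ?_
  filter_upwards [hzero] with y hy
  have hSy : MeasurableSet ((fun x : X => (x, y)) ⁻¹' S) := measurable_prodMk_right hS
  have hey : Measurable fun x => (e (x, y) : ℝ≥0∞) :=
    (hem.comp measurable_prodMk_right).coe_nnreal_ennreal
  have hL : ∫⁻ x, S.indicator (fun p => (e p : ℝ≥0∞)) (x, y) ∂lam
      = ∫⁻ x in (fun x => (x, y)) ⁻¹' S, (e (x, y) : ℝ≥0∞) ∂lam := by
    rw [← lintegral_indicator hSy]
    rfl
  have hR : E y ((fun x => (x, y)) ⁻¹' S)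
      = (∫⁻ x in (fun x => (x, y)) ⁻¹' S, (e (x, y) : ℝ≥0∞) ∂lam) * ((s y)⁻¹ : ℝ≥0) := by
    rw [hEy, withDensity_apply _ hSy, ← lintegral_mul_const _ hey]
    simp [hd]
  rw [hL, Pi.mul_apply]
  change _ = (s y : ℝ≥0∞) * E y ((fun x => (x, y)) ⁻¹' S)
  rw [hR]
  rcases eq_or_ne (s y) 0 with h0 | h0
  · rw [h0]
    simp only [ENNReal.coe_zero, zero_mul]
    exact le_antisymm ((setLIntegral_le_lintegral _ _).trans (hy h0).le) zero_le
  · rw [mul_left_comm, ← ENNReal.coe_mul, mul_inv_cancel₀ h0, ENNReal.coe_one, mul_one]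

end Disintegration

section FibrewiseProblems

open ProbabilityTheory

variable {X Y : Type*} [MeasurableSpace X] {lam : Measure X}

/-- The fibrewise essential infimum of a function on `X × Y`. -/
def essFloor (lam : Measure X) (c : X × Y → ℝ) (y : Y) : ℝ := essInf (fun x => c (x, y)) lam

variable {c : X × Y → ℝ} {C β : ℝ}

theorem essFloor_le_ae (hC : ∀ p, |c p| ≤ C) (y : Y) :
    ∀ᵐ x ∂lam, essFloor lam c y ≤ c (x, y) :=
  ae_essInf_le ⟨-C, Filter.eventually_map.2 (ae_of_all _ fun x => (abs_le.1 (hC (x, y))).1)⟩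

theorem le_essFloor [IsProbabilityMeasure lam] (hC : ∀ p, |c p| ≤ C) {y : Y} {t : ℝ}
    (h : ∀ᵐ x ∂lam, t ≤ c (x, y)) : t ≤ essFloor lam c y := by
  refine le_essInf_of_ae_le t h ?_
  have : Filter.IsBoundedUnder (· ≤ ·) (ae lam) fun x => c (x, y) :=
    ⟨C, Filter.eventually_map.2 (ae_of_all _ fun x => (abs_le.1 (hC (x, y))).2)⟩
  exact this.isCoboundedUnder_ge

theorem abs_essFloor_le [IsProbabilityMeasure lam] (hC : ∀ p, |c p| ≤ C) (y : Y) :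
    |essFloor lam c y| ≤ C := by
  obtain ⟨x, hx⟩ := (essFloor_le_ae (lam := lam) hC y).exists
  exact abs_le.2 ⟨le_essFloor hC (ae_of_all _ fun x => (abs_le.1 (hC (x, y))).1),
    hx.trans (abs_le.1 (hC (x, y))).2⟩

theorem essFloor_lt_iff [IsProbabilityMeasure lam] (hC : ∀ p, |c p| ≤ C) (y : Y) (t : ℝ) :
    essFloor lam c y < t ↔ lam {x | c (x, y) < t} ≠ 0 := by
  have h0 : lam {x | c (x, y) < t} = 0 ↔ ∀ᵐ x ∂lam, t ≤ c (x, y) := by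
    simp [ae_iff]
  rw [← not_le, not_iff_not, h0]
  refine ⟨fun h => ?_, le_essFloor hC⟩
  filter_upwards [essFloor_le_ae (lam := lam) hC y] with x hx using h.trans hx

/-- The cost `c` capped by its fibrewise essential infimum plus twice the transport price. -/
def cappedCost (lam : Measure X) (c : X × Y → ℝ) (β : ℝ) (p : X × Y) : ℝ :=
  min (c p) (essFloor lam c p.2 + 2 * β)

theorem abs_cappedCost_le [IsProbabilityMeasure lam] (hC : ∀ p, |c p| ≤ C) (hβ : 0 ≤ β)
    (p : X × Y) : |cappedCost lam c β p| ≤ C + 2 * β :=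
  abs_truncation_le (hC p) (abs_essFloor_le hC p.2) hβ

theorem isProbabilityMeasure_cond_sublevel [IsProbabilityMeasure lam] (hC : ∀ p, |c p| ≤ C)
    {ε : ℝ} (hε : 0 < ε) (y : Y) :
    IsProbabilityMeasure lam[|{x | c (x, y) < essFloor lam c y + ε}] :=
  cond_isProbabilityMeasure ((essFloor_lt_iff hC y _).1 (by linarith))

variable [MeasurableSpace Y] {nu m : Measure Y}

theorem measurable_essFloor [IsProbabilityMeasure lam] (hc : Measurable c)
    (hC : ∀ p, |c p| ≤ C) : Measurable (essFloor lam c) := by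
  refine measurable_of_Iio fun t => ?_
  have : essFloor lam c ⁻¹' Set.Iio t
      = {y | lam ((fun x => (x, y)) ⁻¹' {p | c p < t}) = 0}ᶜ := by
    ext y
    exact essFloor_lt_iff hC y t
  rw [this]
  exact (measurable_measure_prodMk_right (measurableSet_lt hc measurable_const)
    (measurableSet_singleton 0)).compl

theorem measurable_cappedCost [IsProbabilityMeasure lam] (hc : Measurable c)
    (hC : ∀ p, |c p| ≤ C) : Measurable (cappedCost lam c β) :=
  hc.min (((measurable_essFloor hc hC).comp measurable_snd).add_const _)

theorem integral_cappedCost_le_conditional [IsProbabilityMeasure lam] (hc : Measurable c)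
    (hC : ∀ p, |c p| ≤ C) (hβ : 0 ≤ β) (y : Y) {ψ η : Measure X} [IsProbabilityMeasure ψ]
    [IsProbabilityMeasure η] (hψ : ψ ≪ lam) (hη : η ≪ lam) :
    ∫ x, cappedCost lam c β (x, y) ∂ψ ≤ ∫ x, c (x, y) ∂η + β * tvDist lam η ψ :=
  truncated_integral_le hη hψ (c := fun x => c (x, y)) (w := fun _ => essFloor lam c y)
    (hc.comp measurable_prodMk_right) measurable_const (fun x => hC _)
    (fun _ => abs_essFloor_le hC y) (essFloor_le_ae hC y) hβ (by simp) (by simp)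

theorem iInf_conditional_eq [IsProbabilityMeasure lam] (hc : Measurable c)
    (hC : ∀ p, |c p| ≤ C) (hβ : 0 ≤ β) (y : Y) {ψ : Measure X} [IsProbabilityMeasure ψ]
    (hψ : ψ ≪ lam) :
    ⨅ η : {η : Measure X // IsProbabilityMeasure η ∧ η ≪ lam},
        (∫ x, c (x, y) ∂(η : Measure X) + β * tvDist lam (η : Measure X) ψ)
      = ∫ x, cappedCost lam c β (x, y) ∂ψ := by
  have lower : ∀ η : {η : Measure X // IsProbabilityMeasure η ∧ η ≪ lam},
      ∫ x, cappedCost lam c β (x, y) ∂ψ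
        ≤ ∫ x, c (x, y) ∂(η : Measure X) + β * tvDist lam (η : Measure X) ψ := fun η => by
    have := η.2.1
    exact integral_cappedCost_le_conditional hc hC hβ y hψ η.2.2
  have : Nonempty {η : Measure X // IsProbabilityMeasure η ∧ η ≪ lam} :=
    ⟨⟨ψ, inferInstance, hψ⟩⟩
  refine le_antisymm (le_of_forall_pos_le_add fun ε hε => ?_) (le_ciInf lower)
  have hcy : Measurable fun x => c (x, y) := hc.comp measurable_prodMk_right
  set A : Set X := {x | c (x, y) < essFloor lam c y + ε} with hA
  have hAm : MeasurableSet A := measurableSet_lt hcy measurable_const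
  have := isProbabilityMeasure_cond_sublevel (lam := lam) hC hε y
  set B : Set X := {x | essFloor lam c y + 2 * β < c (x, y)} with hB
  have hBm : MeasurableSet B := measurableSet_lt measurable_const hcy
  have hfin : IsFiniteMeasure (ψ B • lam[|A]) := Measure.smul_finite _ (measure_ne_top _ _)
  obtain ⟨h1, h2, h3⟩ := cost_transfer_le hψ (κ := ψ B • lam[|A])
    (Measure.smul_absolutelyContinuous.trans cond_absolutelyContinuous)
    (c := fun x => c (x, y)) (w := fun _ => essFloor lam c y) hcy measurable_const
    (fun x => hC _) (fun _ => abs_essFloor_le hC y) hβ hε.le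
    (by simp [B, A]) (by simp [B, A, measureReal_def])
    (Measure.smul_absolutelyContinuous.ae_le
      ((ae_cond_mem hAm).mono fun x (hx : c (x, y) < _) => hx.le))
  exact ciInf_le_of_le ⟨_, Set.forall_mem_range.2 lower⟩ ⟨_, h1, h2⟩ h3

theorem integral_cappedCost_le_joint [IsProbabilityMeasure lam] [IsProbabilityMeasure nu]
    (hc : Measurable c) (hC : ∀ p, |c p| ≤ C) (hβ : 0 ≤ β) {P Q : Measure (X × Y)}
    [IsProbabilityMeasure P] [IsProbabilityMeasure Q] (hP : P ≪ lam.prod nu)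
    (hQ : Q ≪ lam.prod nu) (hPQ : P.map Prod.snd = Q.map Prod.snd) :
    ∫ p, cappedCost lam c β p ∂Q ≤ ∫ p, c p ∂P + β * tvDist (lam.prod nu) P Q := by
  have hf := measurable_essFloor (lam := lam) hc hC
  refine truncated_integral_le hP hQ (w := fun p => essFloor lam c p.2) hc
    (hf.comp measurable_snd) hC (fun p => abs_essFloor_le hC p.2) ?_ hβ (by simp) ?_
  · have hS : MeasurableSet {p : X × Y | essFloor lam c p.2 ≤ c p} :=
      measurableSet_le (hf.comp measurable_snd) hc
    have h0 : (lam.prod nu) {p : X × Y | essFloor lam c p.2 ≤ c p}ᶜ = 0 := by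
      rw [Measure.prod_apply_symm hS.compl, lintegral_eq_zero_iff
        (measurable_measure_prodMk_right hS.compl)]
      exact ae_of_all _ fun y => essFloor_le_ae hC y
    exact h0
  · rw [← integral_map (φ := Prod.snd) (f := essFloor lam c) measurable_snd.aemeasurable
      hf.aestronglyMeasurable, hPQ,
      integral_map measurable_snd.aemeasurable hf.aestronglyMeasurable]

theorem iInf_joint_eq [IsProbabilityMeasure lam] [IsProbabilityMeasure nu]
    (hc : Measurable c) (hC : ∀ p, |c p| ≤ C) (hβ : 0 ≤ β) {Q : Measure (X × Y)}
    [IsProbabilityMeasure Q] (hQ : Q ≪ lam.prod nu) :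
    ⨅ P : {P : Measure (X × Y) // IsProbabilityMeasure P ∧ P ≪ lam.prod nu ∧
          P.map Prod.snd = Q.map Prod.snd},
        (∫ p, c p ∂(P : Measure (X × Y)) + β * tvDist (lam.prod nu) (P : Measure (X × Y)) Q)
      = ∫ p, cappedCost lam c β p ∂Q := by
  have lower : ∀ P : {P : Measure (X × Y) // IsProbabilityMeasure P ∧ P ≪ lam.prod nu ∧
          P.map Prod.snd = Q.map Prod.snd},
      ∫ p, cappedCost lam c β p ∂Q ≤ ∫ p, c p ∂(P : Measure (X × Y))
        + β * tvDist (lam.prod nu) (P : Measure (X × Y)) Q := fun P => by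
    have := P.2.1
    exact integral_cappedCost_le_joint hc hC hβ P.2.2.1 hQ P.2.2.2
  have : Nonempty {P : Measure (X × Y) // IsProbabilityMeasure P ∧ P ≪ lam.prod nu ∧
      P.map Prod.snd = Q.map Prod.snd} := ⟨⟨Q, inferInstance, hQ, rfl⟩⟩
  refine le_antisymm (le_of_forall_pos_le_add fun ε hε => ?_) (le_ciInf lower)
  have hf := measurable_essFloor (lam := lam) hc hC
  have hf2 : Measurable fun p : X × Y => essFloor lam c p.2 := hf.comp measurable_snd
  set A : Set (X × Y) := {p | c p < essFloor lam c p.2 + ε} with hA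
  have hAm : MeasurableSet A := measurableSet_lt hc (hf2.add_const _)
  set B : Set (X × Y) := {p | essFloor lam c p.2 + 2 * β < c p} with hB
  have hBm : MeasurableSet B := measurableSet_lt (hf2.add_const _) hc
  have hAy : ∀ y, MeasurableSet {x | c (x, y) < essFloor lam c y + ε} :=
    fun y => measurable_prodMk_right hAm
  let K : Kernel Y X :=
    { toFun := fun y => lam[|{x | c (x, y) < essFloor lam c y + ε}]
      measurable' := by
        refine Measure.measurable_of_measurable_coe _ fun S hS => ?_
        simp_rw [cond_apply (hAy _)]
        refine (measurable_measure_prodMk_right hAm).inv.mul ?_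
        exact measurable_measure_prodMk_right (hAm.inter (measurable_fst hS)) }
  have hK : IsMarkovKernel K := ⟨fun y => isProbabilityMeasure_cond_sublevel hC hε y⟩
  set κ := mixJoint ((Q.restrict B).map Prod.snd) K with hκ
  have hκfin : IsFiniteMeasure κ := isFiniteMeasure_mixJoint K
  have hκsnd : κ.map Prod.snd = (Q.restrict B).map Prod.snd := mixJoint_map_snd K
  have hκac : κ ≪ lam.prod nu := mixJoint_absolutelyContinuous K
    (map_snd_absolutelyContinuous (Measure.restrict_le_self.absolutelyContinuous.trans hQ))
    fun y => cond_absolutelyContinuous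
  have hκA : κ Aᶜ = 0 := by
    rw [hκ, mixJoint_apply K hAm.compl]
    refine lintegral_eq_zero_of_ae_eq_zero (ae_of_all _ fun y => ?_)
    exact ae_cond_mem (μ := lam) (hAy y)
  have hcompl : (Q.restrict Bᶜ + κ).map Prod.snd = Q.map Prod.snd := by
    rw [Measure.map_add _ _ measurable_snd, hκsnd, ← Measure.map_add _ _ measurable_snd,
      add_comm, Measure.restrict_add_restrict_compl hBm]
  obtain ⟨h1, h2, h3⟩ := cost_transfer_le hQ hκac hc hf2 hC (fun p => abs_essFloor_le hC p.2)
    hβ hε.le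
    (by
      rw [← Measure.restrict_apply_univ B, ← Set.preimage_univ (f := Prod.snd (α := X) (β := Y)),
        ← Measure.map_apply measurable_snd .univ, hκsnd,
        Measure.map_apply measurable_snd .univ])
    (by
      rw [← integral_map (φ := Prod.snd) (f := essFloor lam c) measurable_snd.aemeasurable
        hf.aestronglyMeasurable, hκsnd,
        integral_map measurable_snd.aemeasurable hf.aestronglyMeasurable])
    (by
      have : ∀ᵐ p ∂κ, p ∈ A := hκA
      exact this.mono fun p (hp : c p < _) => hp.le)
  exact ciInf_le_of_le ⟨_, Set.forall_mem_range.2 lower⟩ ⟨_, h1, h2, hcompl⟩ h3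

/-- A minimizer of the joint problem disintegrates into minimizers of the fibrewise problems.
The conditional laws are built from the given disintegration `ψ`, so that no countable
generation of the `σ`-algebra on `X` is needed. -/
theorem exists_conditional_minimizer [IsProbabilityMeasure lam] [IsProbabilityMeasure nu]
    (hc : Measurable c) (hC : ∀ p, |c p| ≤ C) (hβ : 0 ≤ β) {P Q : Measure (X × Y)}
    [IsProbabilityMeasure P] [IsProbabilityMeasure Q] (hP : P ≪ lam.prod nu)
    (hQ : Q ≪ lam.prod nu) (hPQ : P.map Prod.snd = Q.map Prod.snd) (ψ : Kernel Y X)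
    [IsMarkovKernel ψ] (hψ : ∀ y, ψ y ≪ lam) (hdis : Q = mixJoint (Q.map Prod.snd) ψ)
    (hmin : ∫ p, c p ∂P + β * tvDist (lam.prod nu) P Q = ∫ p, cappedCost lam c β p ∂Q) :
    ∃ φ : Kernel Y X, IsMarkovKernel φ ∧ P = mixJoint (Q.map Prod.snd) φ ∧
      ∀ᵐ y ∂(Q.map Prod.snd), φ y ≪ lam ∧
        ∫ x, c (x, y) ∂(φ y) + β * tvDist lam (φ y) (ψ y)
          = ∫ x, cappedCost lam c β (x, y) ∂(ψ y) := by
  set m := Q.map Prod.snd with hm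
  have hmprob : IsProbabilityMeasure m :=
    Measure.isProbabilityMeasure_map measurable_snd.aemeasurable
  obtain ⟨k, hkm, hk1, hkP, hktv⟩ := exists_density_common_part hP hQ (by simp)
  set Ψ : Kernel Y X := Kernel.withDensity ψ fun y x => (k (x, y) : ℝ≥0∞) with hΨ
  have hkm' : Measurable (Function.uncurry fun y x => (k (x, y) : ℝ≥0∞)) :=
    (hkm.comp measurable_swap).coe_nnreal_ennreal
  have hΨy : ∀ y, Ψ y = (ψ y).withDensity fun x => (k (x, y) : ℝ≥0∞) :=
    fun y => Kernel.withDensity_apply _ hkm' y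
  have hΨs : IsSFiniteKernel Ψ := by rw [hΨ]; infer_instance
  have hΨle : ∀ y, Ψ y ≤ ψ y := fun y => by
    rw [hΨy]
    conv_rhs => rw [← withDensity_one (μ := ψ y)]
    exact withDensity_mono (ae_of_all _ fun x => ENNReal.coe_le_one_iff.2 (hk1 (x, y)))
  have hΨmix : mixJoint m Ψ = Q.withDensity fun p => (k p : ℝ≥0∞) := by
    rw [hΨ, mixJoint_withDensity ψ hkm, ← hdis]
  set μ := Q.withDensity fun p => (k p : ℝ≥0∞) with hμ
  have hμfin : IsFiniteMeasure μ := isFiniteMeasure_of_le P hkP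
  have hsub : P - μ + μ = P := Measure.sub_add_cancel_of_le hkP
  have hsubm : (P - μ).map Prod.snd ≤ m := by
    rw [← hPQ]
    exact Measure.map_mono Measure.sub_le measurable_snd
  obtain ⟨E, hEs, hEac, hEmix⟩ := exists_kernel_mixJoint_eq (lam := lam) (nu := nu) (m := m)
    (κ := P - μ) (Measure.sub_le.absolutelyContinuous.trans hP)
    (map_snd_absolutelyContinuous hQ) hsubm.absolutelyContinuous
  have hF : mixJoint m (Ψ + E : Kernel Y X) = P := by
    rw [mixJoint_add, hΨmix, ← hEmix, add_comm, hsub]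
  have hF1 : ∀ᵐ y ∂m, (Ψ + E) y Set.univ = 1 :=
    ae_isProbabilityMeasure_of_mixJoint_map_snd (Ψ + E) (by rw [hF, hPQ])
  set S : Set Y := {y | (Ψ + E) y Set.univ = 1} with hS
  have hSm : MeasurableSet S := Kernel.measurable_coe (Ψ + E) .univ (measurableSet_singleton 1)
  classical
  set φ : Kernel Y X := Kernel.piecewise hSm (Ψ + E) (Kernel.const Y lam) with hφ
  have hφS : ∀ y ∈ S, φ y = (Ψ + E) y := fun y hy => by
    rw [hφ, Kernel.piecewise_apply, if_pos hy]
  have hφM : IsMarkovKernel φ := ⟨fun y => by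
    by_cases hy : y ∈ S
    · rw [hφS y hy]
      exact ⟨hy⟩
    · rw [hφ, Kernel.piecewise_apply, if_neg hy, Kernel.const_apply]
      infer_instance⟩
  have hφP : P = mixJoint m φ := by
    rw [← hF]
    exact mixJoint_congr_ae (hF1.mono fun y hy => (hφS y hy).symm)
  have hφac : ∀ y ∈ S, φ y ≪ lam := fun y hy => by
    rw [hφS y hy, add_apply]
    exact Measure.AbsolutelyContinuous.add_left_iff.2
      ⟨(hΨle y).absolutelyContinuous.trans (hψ y), hEac y⟩
  refine ⟨φ, hφM, hφP, ?_⟩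
  have hkr : Measurable fun p => 1 - (k p : ℝ) := measurable_const.sub hkm.coe_nnreal_real
  have hkr1 : ∀ p, |1 - (k p : ℝ)| ≤ 1 := fun p => by
    have h0 : (0 : ℝ) ≤ k p := NNReal.coe_nonneg _
    have h1 : (k p : ℝ) ≤ 1 := by exact_mod_cast hk1 p
    rw [abs_le]; constructor <;> linarith
  have htv : ∀ y ∈ S, tvDist lam (φ y) (ψ y) ≤ 2 * ∫ x, (1 - (k (x, y) : ℝ)) ∂(ψ y) := by
    intro y hy
    have h := tvDist_le_of_common_part (μ := Ψ y) (hφac y hy) (hψ y)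
      (by rw [hφS y hy, add_apply]; exact Measure.le_add_right le_rfl) (hΨle y) (by simp)
    have hint : Integrable (fun x => (k (x, y) : ℝ)) (ψ y) :=
      integrable_of_bounded (C := 1) (hkm.comp measurable_prodMk_right).coe_nnreal_real
        fun x => by
          rw [NNReal.abs_eq]
          exact_mod_cast hk1 (x, y)
    have hmass : (Ψ y).real Set.univ = ∫ x, (k (x, y) : ℝ) ∂(ψ y) := by
      rw [measureReal_def, hΨy, withDensity_apply _ .univ, Measure.restrict_univ,
        integral_eq_lintegral_of_nonneg_ae (ae_of_all _ fun x => NNReal.coe_nonneg _)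
          hint.aestronglyMeasurable]
      simp
    rwa [hmass, show (ψ y).real Set.univ - ∫ x, (k (x, y) : ℝ) ∂(ψ y)
      = ∫ x, (1 - (k (x, y) : ℝ)) ∂(ψ y) by
        rw [integral_sub (integrable_const _) hint]; simp] at h
  have iV : Integrable (fun y => ∫ x, cappedCost lam c β (x, y) ∂(ψ y)) m :=
    integrable_integral_kernel ψ (measurable_cappedCost hc hC) (abs_cappedCost_le hC hβ)
  have ic : Integrable (fun y => ∫ x, c (x, y) ∂(φ y)) m := integrable_integral_kernel φ hc hC
  have ik : Integrable (fun y => ∫ x, (1 - (k (x, y) : ℝ)) ∂(ψ y)) m :=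
    integrable_integral_kernel ψ hkr hkr1
  have hlow : ∀ y ∈ S, ∫ x, cappedCost lam c β (x, y) ∂(ψ y)
      ≤ ∫ x, c (x, y) ∂(φ y) + β * tvDist lam (φ y) (ψ y) := fun y hy =>
    integral_cappedCost_le_conditional hc hC hβ y (hψ y) (hφac y hy)
  have hupp : ∀ y ∈ S, ∫ x, c (x, y) ∂(φ y) + β * tvDist lam (φ y) (ψ y)
      ≤ ∫ x, c (x, y) ∂(φ y) + 2 * β * ∫ x, (1 - (k (x, y) : ℝ)) ∂(ψ y) := fun y hy => by
    nlinarith [mul_le_mul_of_nonneg_left (htv y hy) hβ]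
  have hG : Integrable (fun y => ∫ x, c (x, y) ∂(φ y)
      + 2 * β * ∫ x, (1 - (k (x, y) : ℝ)) ∂(ψ y)) m := ic.add (ik.const_mul _)
  have heq : ∫ y, ∫ x, cappedCost lam c β (x, y) ∂(ψ y) ∂m
      = ∫ y, (∫ x, c (x, y) ∂(φ y) + 2 * β * ∫ x, (1 - (k (x, y) : ℝ)) ∂(ψ y)) ∂m := by
    rw [integral_add ic (ik.const_mul _), integral_const_mul,
      ← integral_mixJoint ψ (measurable_cappedCost hc hC) (abs_cappedCost_le hC hβ),
      ← integral_mixJoint φ hc hC, ← integral_mixJoint ψ hkr hkr1, ← hdis, ← hφP, ← hmin, ← hktv]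
    ring
  have hae := (integral_eq_iff_of_ae_le iV hG
    (hF1.mono fun y hy => (hlow y hy).trans (hupp y hy))).1 heq
  filter_upwards [hae, hF1] with y hy hyS
  exact ⟨hφac y hyS, le_antisymm ((hupp y hyS).trans hy.ge) (hlow y hyS)⟩

end FibrewiseProblems

section StageProblems

open ProbabilityTheory

variable {X Y A : Type*} [MeasurableSpace X] [MeasurableSpace Y] [MeasurableSpace A]
  {M : ManipSetting X Y A}

theorem weighted_cost_eq {Z : Type*} [MeasurableSpace Z] {μ : Measure Z} [IsFiniteMeasure μ]
    {f g : Z → ℝ} {C D : ℝ} (hf : Measurable f) (hg : Measurable g) (hfC : ∀ z, |f z| ≤ C)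
    (hgD : ∀ z, |g z| ≤ D) (β t : ℝ) :
    β * (∫ z, f z ∂μ + t) + ∫ z, g z ∂μ = ∫ z, (β * f z + g z) ∂μ + β * t := by
  rw [integral_add ((integrable_of_bounded hf hfC).const_mul β) (integrable_of_bounded hg hgD),
    integral_const_mul]
  ring

namespace ManipSetting

/-- Total cost at stage `n`: the weighted running cost plus the continuation value `W_j`. -/
def stageCost (M : ManipSetting X Y A) (β : ℝ) (n j : ℕ) (p : X × Y) : ℝ :=
  β * M.r p.1 p.2 (M.g n p.1) + M.Wrec j p.1 p.2 (M.g n p.1)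

theorem Qm_absolutelyContinuous (x : X) (y : Y) (a : A) : M.Qm x y a ≪ M.lam.prod M.nu :=
  withDensity_absolutelyContinuous _ _

theorem Q0m_absolutelyContinuous : M.Q0m ≪ M.lam.prod M.nu :=
  withDensity_absolutelyContinuous _ _

end ManipSetting

namespace ManipHyps

theorem isProbabilityMeasure_Qm (hM : ManipHyps M) (x : X) (y : Y) (a : A) :
    IsProbabilityMeasure (M.Qm x y a) := by
  constructor
  rw [ManipSetting.Qm, withDensity_apply _ .univ, Measure.restrict_univ, hM.q_dens]

theorem isProbabilityMeasure_Q0m (hM : ManipHyps M) : IsProbabilityMeasure M.Q0m := by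
  constructor
  rw [ManipSetting.Q0m, withDensity_apply _ .univ, Measure.restrict_univ, hM.q0_dens]

theorem measurable_runningCost (hM : ManipHyps M) (n : ℕ) :
    Measurable fun p : X × Y => M.r p.1 p.2 (M.g n p.1) :=
  hM.r_meas.comp (measurable_fst.prodMk
    (measurable_snd.prodMk ((hM.g_meas n).comp measurable_fst)))

theorem exists_abs_runningCost_le (hM : ManipHyps M) :
    ∃ C, ∀ x y a, |M.r x y a| ≤ C := by
  obtain ⟨C, hC⟩ := hM.r_bdd
  exact ⟨C, fun x y a => by rw [abs_of_nonneg (hM.r_nonneg x y a)]; exact hC x y a⟩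

/-- A value function that is jointly measurable and bounded. -/
def RegularValue (V : X → Y → A → ℝ) : Prop :=
  (Measurable fun p : X × Y × A => V p.1 p.2.1 p.2.2) ∧ ∃ C, ∀ x y a, |V x y a| ≤ C

theorem stageCost_regular (hM : ManipHyps M) {j : ℕ} (hj : RegularValue (M.Wrec j)) (β : ℝ)
    (n : ℕ) : Measurable (M.stageCost β n j) ∧ ∃ C, ∀ p, |M.stageCost β n j p| ≤ C := by
  obtain ⟨hW, D, hD⟩ := hj
  obtain ⟨C, hC⟩ := hM.exists_abs_runningCost_le
  refine ⟨((hM.measurable_runningCost n).const_mul β).add (hW.comp (measurable_fst.prodMk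
    (measurable_snd.prodMk ((hM.g_meas n).comp measurable_fst)))), |β| * C + D, fun p => ?_⟩
  refine (abs_add_le _ _).trans (add_le_add ?_ (hD _ _ _))
  rw [abs_mul]
  exact mul_le_mul_of_nonneg_left (hC _ _ _) (abs_nonneg β)

theorem joint_cost_eq (hM : ManipHyps M) {j : ℕ} (hj : RegularValue (M.Wrec j)) (β : ℝ) (n : ℕ)
    (P : Measure (X × Y)) [IsFiniteMeasure P] (t : ℝ) :
    β * (∫ p, M.r p.1 p.2 (M.g n p.1) ∂P + t) + ∫ p, M.Wrec j p.1 p.2 (M.g n p.1) ∂P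
      = ∫ p, M.stageCost β n j p ∂P + β * t := by
  obtain ⟨hW, D, hD⟩ := hj
  obtain ⟨C, hC⟩ := hM.exists_abs_runningCost_le
  exact weighted_cost_eq (hM.measurable_runningCost n) (hW.comp (measurable_fst.prodMk
    (measurable_snd.prodMk ((hM.g_meas n).comp measurable_fst)))) (fun p => hC _ _ _)
    (fun p => hD _ _ _) β t

theorem conditional_cost_eq (hM : ManipHyps M) {j : ℕ} (hj : RegularValue (M.Wrec j)) (β : ℝ)
    (n : ℕ) (y : Y) (η : Measure X) [IsFiniteMeasure η] (t : ℝ) :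
    β * (∫ x, M.r x y (M.g n x) ∂η + t) + ∫ x, M.Wrec j x y (M.g n x) ∂η
      = ∫ x, M.stageCost β n j (x, y) ∂η + β * t := by
  obtain ⟨hW, D, hD⟩ := hj
  obtain ⟨C, hC⟩ := hM.exists_abs_runningCost_le
  exact weighted_cost_eq ((hM.measurable_runningCost n).comp measurable_prodMk_right)
    (hW.comp (measurable_id.prodMk (measurable_const.prodMk (hM.g_meas n))))
    (fun x => hC _ _ _) (fun x => hD _ _ _) β t

theorem Wrec_succ_eq (hM : ManipHyps M) {j : ℕ} (hj : RegularValue (M.Wrec j)) (x : X) (y : Y)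
    (a : A) :
    M.Wrec (j + 1) x y a = ∫ p, cappedCost M.lam
      (M.stageCost (M.alpha ^ (M.N - (j + 1))) (M.N - (j + 1)) j)
      (M.alpha ^ (M.N - (j + 1))) p ∂(M.Qm x y a) := by
  have := hM.lam_prob
  have := hM.nu_prob
  have := hM.isProbabilityMeasure_Qm x y a
  obtain ⟨hc, C, hC⟩ := hM.stageCost_regular hj (M.alpha ^ (M.N - (j + 1))) (M.N - (j + 1))
  rw [← iInf_joint_eq hc hC (pow_nonneg hM.alpha_pos.le _)
    (M.Qm_absolutelyContinuous x y a), ManipSetting.Wrec]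
  refine iInf_congr fun P => ?_
  have := P.2.1
  exact hM.joint_cost_eq hj _ _ _ _

theorem regularValue_Wrec (hM : ManipHyps M) (j : ℕ) : RegularValue (M.Wrec j) := by
  have := hM.lam_prob
  have := hM.nu_prob
  induction j with
  | zero => exact ⟨by simp only [ManipSetting.Wrec]; exact measurable_const, 0, by
      simp [ManipSetting.Wrec]⟩
  | succ j ih =>
    obtain ⟨hc, C, hC⟩ := hM.stageCost_regular ih (M.alpha ^ (M.N - (j + 1))) (M.N - (j + 1))
    have hβ : 0 ≤ M.alpha ^ (M.N - (j + 1)) := pow_nonneg hM.alpha_pos.le _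
    have hm := measurable_cappedCost (lam := M.lam) (β := M.alpha ^ (M.N - (j + 1))) hc hC
    have hb := abs_cappedCost_le (lam := M.lam) hC hβ
    constructor
    · simp_rw [hM.Wrec_succ_eq ih]
      have hq : ∀ z : X × Y × A, Measurable fun p : X × Y => M.q p.1 p.2 z.1 z.2.1 z.2.2 :=
        fun z => hM.q_meas.comp (f := fun p : X × Y => (p.1, p.2, z)) (by fun_prop)
      have : ∀ z : X × Y × A, ∫ p, cappedCost M.lam
          (M.stageCost (M.alpha ^ (M.N - (j + 1))) (M.N - (j + 1)) j)
          (M.alpha ^ (M.N - (j + 1))) p ∂(M.Qm z.1 z.2.1 z.2.2)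
          = ∫ p, M.q p.1 p.2 z.1 z.2.1 z.2.2 * cappedCost M.lam
            (M.stageCost (M.alpha ^ (M.N - (j + 1))) (M.N - (j + 1)) j)
            (M.alpha ^ (M.N - (j + 1))) p ∂(M.lam.prod M.nu) := fun z => by
        rw [ManipSetting.Qm, integral_withDensity_eq_integral_toReal_smul
          (hq z).ennreal_ofReal (ae_of_all _ fun p => ENNReal.ofReal_lt_top)]
        refine integral_congr_ae (ae_of_all _ fun p => ?_)
        simp only [smul_eq_mul]
        rw [ENNReal.toReal_ofReal (hM.q_nonneg _ _ _ _ _)]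
      simp_rw [this]
      refine (StronglyMeasurable.integral_prod_right
        (f := fun (z : X × Y × A) (p : X × Y) => M.q p.1 p.2 z.1 z.2.1 z.2.2 * cappedCost M.lam
            (M.stageCost (M.alpha ^ (M.N - (j + 1))) (M.N - (j + 1)) j)
            (M.alpha ^ (M.N - (j + 1))) p) (Measurable.stronglyMeasurable ?_)).measurable
      exact (hM.q_meas.comp (f := fun w : (X × Y × A) × (X × Y) => (w.2.1, w.2.2, w.1))
        (by fun_prop)).mul (hm.comp measurable_snd)
    · refine ⟨C + 2 * M.alpha ^ (M.N - (j + 1)), fun x y a => ?_⟩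
      have := hM.isProbabilityMeasure_Qm x y a
      rw [hM.Wrec_succ_eq ih]
      have := norm_integral_le_of_norm_le_const (μ := M.Qm x y a) (ae_of_all _ fun p =>
        (Real.norm_eq_abs _).le.trans (hb p))
      simpa [Real.norm_eq_abs] using this

theorem WNval_eq (hM : ManipHyps M) :
    M.WNval = ∫ p, cappedCost M.lam (M.stageCost 1 0 (M.N - 1)) 1 p ∂M.Q0m := by
  have := hM.lam_prob
  have := hM.nu_prob
  have := hM.isProbabilityMeasure_Q0m
  have hj := hM.regularValue_Wrec (M.N - 1)
  obtain ⟨hc, C, hC⟩ := hM.stageCost_regular hj 1 0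
  rw [← iInf_joint_eq hc hC zero_le_one M.Q0m_absolutelyContinuous, ManipSetting.WNval]
  refine iInf_congr fun P => ?_
  have := P.2.1
  rw [← hM.joint_cost_eq hj, one_mul]
  rfl

theorem WYval_eq (hM : ManipHyps M) {ψ : X → Y → A → Y → Measure X} {ψ0 : Y → Measure X}
    (hdis : DisintHyps M ψ ψ0) (j : ℕ) (y' : Y) (x : X) (y : Y) (a : A) :
    M.WYval ψ j y' x y a = ∫ x', cappedCost M.lam
      (M.stageCost (M.alpha ^ (M.N - j)) (M.N - j) (j - 1)) (M.alpha ^ (M.N - j)) (x', y')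
      ∂(ψ x y a y') := by
  have := hM.lam_prob
  have := hdis.ψ_prob x y a y'
  have hj := hM.regularValue_Wrec (j - 1)
  obtain ⟨hc, C, hC⟩ := hM.stageCost_regular hj (M.alpha ^ (M.N - j)) (M.N - j)
  rw [← iInf_conditional_eq hc hC (pow_nonneg hM.alpha_pos.le _) y' (hdis.ψ_ac x y a y'),
    ManipSetting.WYval]
  refine iInf_congr fun η => ?_
  have := η.2.1
  exact hM.conditional_cost_eq hj _ _ _ _ _

theorem WY0val_eq (hM : ManipHyps M) {ψ : X → Y → A → Y → Measure X} {ψ0 : Y → Measure X}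
    (hdis : DisintHyps M ψ ψ0) (y : Y) :
    M.WY0val ψ0 y
      = ∫ x, cappedCost M.lam (M.stageCost 1 0 (M.N - 1)) 1 (x, y) ∂(ψ0 y) := by
  have := hM.lam_prob
  have := hdis.ψ0_prob y
  have hj := hM.regularValue_Wrec (M.N - 1)
  obtain ⟨hc, C, hC⟩ := hM.stageCost_regular hj 1 0
  rw [← iInf_conditional_eq hc hC zero_le_one y (hdis.ψ0_ac y), ManipSetting.WY0val]
  refine iInf_congr fun η => ?_
  have := η.2.1
  rw [← hM.conditional_cost_eq hj, one_mul]
  rfl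

end ManipHyps

end StageProblems

/-- interim equilibrium of information distortion, Corollary 1: let
`P_n*(·|x,y,a)` be stage minimizers of the ex ante backward recursion (together with a stage-0
minimizer `P_0*`), which exist under the nonempty-compactness assumption on the interim
solution sets.  Then each `P_n*(·|x,y,a)` admits a disintegration
`P_n*(dx',dy'|x,y,a) = φ_n*(dx'|y'; x,y,a) Q^Y(dy'|x,y,a)` by a stochastic kernel `φ_n*`
whose conditional laws attain the interim stage values `W^Y_{N−n}(y'; x,y,a)` for
`Q^Y(·|x,y,a)`-almost every `y'`; the analogous statement holds at stage `0` with `Q_0` and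
`Q_0^Y`.  Consequently the family `(φ_0*,…,φ_{N−1}*)` together with the decision-maker's
rules constitutes an interim equilibrium of information distortion, and the interim value
coincides with the ex ante value: `W_N = ∫ W^Y_N(y; Q_0) Q_0^Y(dy)`. -/
theorem interim_equilibrium {X Y A : Type*}
    [MeasurableSpace X] [TopologicalSpace X] [OpensMeasurableSpace X]
    [MeasurableSpace Y] [MeasurableSpace A]
    (M : ManipSetting X Y A) (hM : ManipHyps M)
    (ψ : X → Y → A → Y → Measure X) (ψ0 : Y → Measure X) (hdis : DisintHyps M ψ ψ0)
    (hsol : ∀ j x y a y', 1 ≤ j → j ≤ M.N - 1 →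
        (interimSolSet M ψ j y' x y a).Nonempty ∧ IsCompact (interimSolSet M ψ j y' x y a))
    (hsol0 : ∀ y, (interim0SolSet M ψ0 y).Nonempty ∧ IsCompact (interim0SolSet M ψ0 y))
    -- the given stage minimizers of the ex ante backward recursion
    (Pkstar : ℕ → X → Y → A → Measure (X × Y)) (P0star : Measure (X × Y))
    (hPk : ∀ n, 1 ≤ n → n ≤ M.N - 1 → ∀ (x : X) (y : Y) (a : A),
        M.Feas x y a (Pkstar n x y a)
          ∧ M.stageObj (M.N - n) x y a (Pkstar n x y a) = M.Wrec (M.N - n) x y a)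
    (hP0 : M.Feas0 P0star ∧ M.stage0Obj P0star = M.WNval) :
    (∀ n, 1 ≤ n → n ≤ M.N - 1 → ∀ (x : X) (y : Y) (a : A),
        ∃ φ : Y → Measure X, Measurable φ ∧ (∀ y', IsProbabilityMeasure (φ y'))
          ∧ Pkstar n x y a = mixJoint (M.QY x y a) φ
          ∧ ∀ᵐ y' ∂(M.QY x y a), φ y' ≪ M.lam
              ∧ M.interimObj ψ (M.N - n) y' x y a (φ y') = M.WYval ψ (M.N - n) y' x y a)
      ∧ (∃ φ0 : Y → Measure X, Measurable φ0 ∧ (∀ y, IsProbabilityMeasure (φ0 y))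
          ∧ P0star = mixJoint M.Q0Y φ0
          ∧ ∀ᵐ y ∂M.Q0Y, φ0 y ≪ M.lam
              ∧ M.interim0Obj ψ0 y (φ0 y) = M.WY0val ψ0 y)
      ∧ M.WNval = ∫ y, M.WY0val ψ0 y ∂M.Q0Y := by
  have := hM.lam_prob
  have := hM.nu_prob
  refine ⟨fun n hn hnN x y a => ?_, ?_, ?_⟩
  · obtain ⟨⟨hPprob, hPac, hPm⟩, hPmin⟩ := hPk n hn hnN x y a
    have := hM.isProbabilityMeasure_Qm x y a
    obtain ⟨i, hi⟩ : ∃ i, M.N - n = i + 1 := ⟨M.N - n - 1, by omega⟩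
    rw [hi] at hPmin ⊢
    have hj := hM.regularValue_Wrec i
    obtain ⟨hc, C, hC⟩ := hM.stageCost_regular hj (M.alpha ^ (M.N - (i + 1))) (M.N - (i + 1))
    let ψK : ProbabilityTheory.Kernel Y X := ⟨ψ x y a, hdis.ψ_meas x y a⟩
    have hψK : ProbabilityTheory.IsMarkovKernel ψK := ⟨hdis.ψ_prob x y a⟩
    obtain ⟨φ, hφM, hφP, hφ⟩ := exists_conditional_minimizer hc hC
      (pow_nonneg hM.alpha_pos.le (M.N - (i + 1))) hPac (M.Qm_absolutelyContinuous x y a) hPm ψK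
      (hdis.ψ_ac x y a) (hdis.ψ_dis x y a)
      (by
        rw [← hM.Wrec_succ_eq hj, ← hPmin, ← hM.joint_cost_eq hj]
        rfl)
    refine ⟨φ, φ.measurable, hφM.isProbabilityMeasure, hφP, hφ.mono fun y' h => ⟨h.1, ?_⟩⟩
    rw [hM.WYval_eq hdis]
    refine Eq.trans ?_ h.2
    exact hM.conditional_cost_eq hj _ _ _ _ _
  · obtain ⟨⟨hPprob, hPac, hPm⟩, hPmin⟩ := hP0
    have := hM.isProbabilityMeasure_Q0m
    have hj := hM.regularValue_Wrec (M.N - 1)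
    obtain ⟨hc, C, hC⟩ := hM.stageCost_regular hj 1 0
    let ψK : ProbabilityTheory.Kernel Y X := ⟨ψ0, hdis.ψ0_meas⟩
    have hψK : ProbabilityTheory.IsMarkovKernel ψK := ⟨hdis.ψ0_prob⟩
    obtain ⟨φ, hφM, hφP, hφ⟩ := exists_conditional_minimizer hc hC zero_le_one hPac
      M.Q0m_absolutelyContinuous hPm ψK hdis.ψ0_ac hdis.ψ0_dis
      (by
        rw [← hM.WNval_eq, ← hPmin, ← hM.joint_cost_eq hj, one_mul]
        rfl)
    refine ⟨φ, φ.measurable, hφM.isProbabilityMeasure, hφP, hφ.mono fun y' h => ⟨h.1, ?_⟩⟩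
    rw [hM.WY0val_eq hdis]
    refine Eq.trans ?_ h.2
    rw [← hM.conditional_cost_eq hj, one_mul]
    rfl
  · have := hM.isProbabilityMeasure_Q0m
    have : IsProbabilityMeasure M.Q0Y :=
      Measure.isProbabilityMeasure_map measurable_snd.aemeasurable
    obtain ⟨hc, C, hC⟩ := hM.stageCost_regular (hM.regularValue_Wrec (M.N - 1)) 1 0
    let ψK : ProbabilityTheory.Kernel Y X := ⟨ψ0, hdis.ψ0_meas⟩
    have hψK : ProbabilityTheory.IsMarkovKernel ψK := ⟨hdis.ψ0_prob⟩
    simp_rw [hM.WY0val_eq hdis]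
    rw [hM.WNval_eq, hdis.ψ0_dis]
    exact integral_mixJoint ψK (measurable_cappedCost hc hC) (abs_cappedCost_le hC zero_le_one)

end DIMG
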